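/- arXiv:1007.2214 — 2 statements merged into one kernel-verified Lean document; each statement's English description precedes it below -/
import Mathlib

section
/- Let 1 ≤ p < ∞ and let m > n be natural numbers. In L^p[0, 1] (with Lebesgue measure) let Rad_k = span{r_0, ..., r_k}, where r_j(t) = (−1)^{⌊2^j t⌋} are the Rademacher functions. Then the Rademacher projection R_n : Rad_m → Rad_n defined by R_n f = Σ_{j=0}^{n} (∫_0^1 f(t) r_j(t) dt) r_j is the unique linear projection of Rad_m onto Rad_n commuting with all dyadic translations T_g, (T_g f)(x) = f(x ⊕ g) (g ∈ [0, 1]), and R_n is a minimal projection with respect to the L^p operator norm: ‖R_n‖_p ≤ ‖P‖_p for every linear projection P of Rad_m onto Rad_n, where ‖·‖_p denotes the operator norm induced by the L^p[0, 1] norm. -/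
open MeasureTheory ENNReal

noncomputable section

/-- The `k`-th binary digit `x_k ∈ {0,1}` of `x ∈ [0,1]`, so that
`x = ∑_k x_k 2^{-(k+1)}`, choosing for dyadic rationals the expansion terminating in `0`s
(and for `x = 1` the all-ones expansion, its only binary expansion). -/
def dyadicDigit (x : ℝ) (k : ℕ) : ℕ :=
  if x = 1 then 1 else ⌊2 ^ (k + 1) * x⌋.toNat % 2

/-- Dyadic addition on `[0,1]`: `x ⊕ y = ∑_k |x_k − y_k| 2^{-(k+1)}`. -/
def dyadicAdd (x y : ℝ) : ℝ :=
  ∑' k : ℕ, |(dyadicDigit x k : ℝ) - (dyadicDigit y k : ℝ)| / 2 ^ (k + 1)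

/-- The `j`-th Rademacher function `r_j(t) = (−1)^{⌊2^j t⌋}`. -/
def rademacher (j : ℕ) (t : ℝ) : ℝ :=
  (-1 : ℝ) ^ ⌊2 ^ j * t⌋

/-- Lebesgue measure on `[0,1]`. -/
def leb01 : Measure ℝ := volume.restrict (Set.Icc (0 : ℝ) 1)

/-- The space `L^p[0,1]`. -/
abbrev Lp01 (p : ℝ≥0∞) := Lp ℝ p leb01

/-- The operator norm, induced by the `L^p[0,1]` norm, of a linear map of a subspace of
`L^p[0,1]` into itself: `sup { ‖T f‖_p : ‖f‖_p ≤ 1 }`. -/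
def opNormLp {p : ℝ≥0∞} (S : Submodule ℝ (Lp01 p)) (T : ↥S →ₗ[ℝ] ↥S) : ℝ :=
  sSup {s : ℝ | ∃ f : ↥S, ‖(f : Lp01 p)‖ ≤ 1 ∧ s = ‖(T f : Lp01 p)‖}

open Filter Topology Set

lemma rademacher_eq_one_or_neg_one (j : ℕ) (x : ℝ) :
    rademacher j x = 1 ∨ rademacher j x = -1 := by
  unfold rademacher
  rcases Int.even_or_odd ⌊2 ^ j * x⌋ with h | h
  · exact Or.inl h.neg_one_zpow
  · exact Or.inr h.neg_one_zpow

lemma rademacher_mul_self (j : ℕ) (x : ℝ) : rademacher j x * rademacher j x = 1 := by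
  rcases rademacher_eq_one_or_neg_one j x with h | h <;> simp [h]

lemma measurable_rademacher (j : ℕ) : Measurable (rademacher j) :=
  (measurable_from_top (f := fun z : ℤ => (-1 : ℝ) ^ z)).comp
    (Int.measurable_floor.comp (measurable_const_mul (2 ^ j : ℝ)))

lemma rademacher_add (j : ℕ) (x : ℝ) : rademacher j (x + 1 / 2 ^ j) = -rademacher j x := by
  have h : (2 : ℝ) ^ j * (x + 1 / 2 ^ j) = 2 ^ j * x + 1 := by field_simp
  unfold rademacher
  rw [h, Int.floor_add_one, zpow_add_one₀ (by norm_num)]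
  ring

lemma rademacher_sub (j : ℕ) (x : ℝ) : rademacher j (x - 1 / 2 ^ j) = -rademacher j x := by
  have h := rademacher_add j (x - 1 / 2 ^ j)
  rw [sub_add_cancel] at h
  linarith

lemma rademacher_add_of_lt {j k : ℕ} (hkj : k < j) (x : ℝ) :
    rademacher j (x + 1 / 2 ^ k) = rademacher j x := by
  obtain ⟨l, rfl⟩ := Nat.exists_eq_add_of_lt hkj
  have h : (2 : ℝ) ^ (k + l + 1) * (x + 1 / 2 ^ k) =
      2 ^ (k + l + 1) * x + ((2 * 2 ^ l : ℤ) : ℝ) := by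
    push_cast
    field_simp
    ring
  unfold rademacher
  rw [h, Int.floor_add_intCast, zpow_add₀ (by norm_num), (even_two_mul _).neg_one_zpow, mul_one]

lemma rademacher_sub_of_lt {j k : ℕ} (hkj : k < j) (x : ℝ) :
    rademacher j (x - 1 / 2 ^ k) = rademacher j x := by
  have h := rademacher_add_of_lt hkj (x - 1 / 2 ^ k)
  rwa [sub_add_cancel, eq_comm] at h

/-- The map exchanging `0` and `1` in the `k`-th binary digit. -/
def bitFlip (k : ℕ) (x : ℝ) : ℝ := x + rademacher (k + 1) x / 2 ^ (k + 1)

lemma bitFlip_of_eq_one {k : ℕ} {x : ℝ} (h : rademacher (k + 1) x = 1) :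
    bitFlip k x = x + 1 / 2 ^ (k + 1) := by
  rw [bitFlip, h]

lemma bitFlip_of_eq_neg_one {k : ℕ} {x : ℝ} (h : rademacher (k + 1) x = -1) :
    bitFlip k x = x - 1 / 2 ^ (k + 1) := by
  rw [bitFlip, h]
  ring

lemma measurable_bitFlip (k : ℕ) : Measurable (bitFlip k) :=
  measurable_id.add ((measurable_rademacher (k + 1)).div_const _)

lemma floor_mul_bitFlip {j k : ℕ} (hjk : j ≤ k) (x : ℝ) :
    ⌊2 ^ j * bitFlip k x⌋ = ⌊2 ^ j * x⌋ := by
  obtain ⟨l, rfl⟩ := Nat.exists_eq_add_of_le hjk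
  have key : ∀ y : ℝ, ⌊2 ^ j * y⌋ = ⌊2 ^ (j + l + 1) * y⌋ / 2 / (2 ^ l : ℕ) := by
    intro y
    have h : (2 : ℝ) ^ j * y = (2 ^ (j + l + 1) * y) / (2 : ℕ) / (2 ^ l : ℕ) := by
      push_cast
      field_simp
      ring
    rw [h, Int.floor_div_natCast, Int.floor_div_natCast]
    rfl
  rw [key, key]
  congr 1
  have hpos : (2 : ℝ) ^ (j + l + 1) ≠ 0 := by positivity
  rcases Int.even_or_odd ⌊2 ^ (j + l + 1) * x⌋ with h | h
  · rw [bitFlip_of_eq_one h.neg_one_zpow, mul_add, mul_one_div_cancel hpos, Int.floor_add_one]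
    obtain ⟨q, hq⟩ := h
    omega
  · rw [bitFlip_of_eq_neg_one h.neg_one_zpow, mul_sub, mul_one_div_cancel hpos, Int.floor_sub_one]
    obtain ⟨q, hq⟩ := h
    omega

lemma rademacher_bitFlip_self (k : ℕ) (x : ℝ) :
    rademacher (k + 1) (bitFlip k x) = -rademacher (k + 1) x := by
  rcases rademacher_eq_one_or_neg_one (k + 1) x with h | h
  · rw [bitFlip_of_eq_one h, rademacher_add]
  · rw [bitFlip_of_eq_neg_one h, rademacher_sub]

lemma rademacher_bitFlip_of_ne {j k : ℕ} (hjk : j ≠ k + 1) (x : ℝ) :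
    rademacher j (bitFlip k x) = rademacher j x := by
  rcases hjk.lt_or_gt with hlt | hgt
  · rw [rademacher, floor_mul_bitFlip (Nat.le_of_lt_succ hlt), rademacher]
  · rcases rademacher_eq_one_or_neg_one (k + 1) x with h | h
    · rw [bitFlip_of_eq_one h, rademacher_add_of_lt hgt]
    · rw [bitFlip_of_eq_neg_one h, rademacher_sub_of_lt hgt]

lemma measurePreserving_bitFlip (k : ℕ) : MeasurePreserving (bitFlip k) volume volume := by
  refine ⟨measurable_bitFlip k, Measure.ext fun A hA => ?_⟩
  set E : Set ℝ := {x | rademacher (k + 1) x = 1} with hE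
  have hEm : MeasurableSet E := measurable_rademacher (k + 1) (measurableSet_singleton 1)
  have h₁ : bitFlip k ⁻¹' A ∩ E = (fun x => x + 1 / 2 ^ (k + 1)) ⁻¹' (A \ E) := by
    ext x
    simp only [mem_inter_iff, mem_preimage, Set.mem_sdiff, hE, mem_ofPred_eq, rademacher_add]
    rcases rademacher_eq_one_or_neg_one (k + 1) x with h | h
    · rw [bitFlip_of_eq_one h, h]
      norm_num
    · rw [h]
      norm_num
  have h₂ : bitFlip k ⁻¹' A \ E = (fun x => x + -(1 / 2 ^ (k + 1))) ⁻¹' (A ∩ E) := by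
    ext x
    simp only [mem_inter_iff, mem_preimage, Set.mem_sdiff, hE, mem_ofPred_eq, ← sub_eq_add_neg, rademacher_sub]
    rcases rademacher_eq_one_or_neg_one (k + 1) x with h | h
    · rw [h]
      norm_num
    · rw [bitFlip_of_eq_neg_one h, h]
      norm_num
  rw [Measure.map_apply (measurable_bitFlip k) hA, ← measure_inter_add_sdiff _ hEm, h₁, h₂,
    measure_preimage_add_right, measure_preimage_add_right, add_comm,
    measure_inter_add_sdiff _ hEm]

lemma leb01_eq_restrict_Ico : leb01 = volume.restrict (Ico (0 : ℝ) 1) :=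
  Measure.restrict_congr_set Ico_ae_eq_Icc.symm

instance : IsProbabilityMeasure leb01 := ⟨by simp [leb01]⟩

instance : NullSingletonClass leb01 := by unfold leb01; infer_instance

lemma ae_leb01_mem_Ico : ∀ᵐ x ∂leb01, x ∈ Ico (0 : ℝ) 1 := by
  rw [leb01_eq_restrict_Ico]
  exact ae_restrict_mem measurableSet_Ico

lemma measurePreserving_bitFlip_leb01 (k : ℕ) : MeasurePreserving (bitFlip k) leb01 leb01 := by
  have h := (measurePreserving_bitFlip k).restrict_preimage (measurableSet_Ico (a := 0) (b := 1))
  have hpre : bitFlip k ⁻¹' Ico 0 1 = Ico 0 1 := by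
    ext x
    have := floor_mul_bitFlip (Nat.zero_le k) x
    rw [pow_zero, one_mul, one_mul] at this
    rw [mem_preimage, ← Int.floor_eq_zero_iff, ← Int.floor_eq_zero_iff, this]
  rwa [hpre, ← leb01_eq_restrict_Ico] at h

lemma integral_rademacher_mul (i j : ℕ) :
    ∫ x, rademacher i x * rademacher j x ∂leb01 = if i = j then 1 else 0 := by
  have key : ∀ {i j : ℕ}, i < j → ∫ x, rademacher i x * rademacher j x ∂leb01 = 0 := by
    intro i j hij
    obtain ⟨k, rfl⟩ := Nat.exists_eq_succ_of_ne_zero (Nat.ne_zero_of_lt hij)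
    have hmp := measurePreserving_bitFlip_leb01 k
    have hmeas : Measurable fun x => rademacher i x * rademacher (k + 1) x :=
      (measurable_rademacher i).mul (measurable_rademacher (k + 1))
    have h : ∫ x, rademacher i x * rademacher (k + 1) x ∂leb01 =
        ∫ x, -(rademacher i x * rademacher (k + 1) x) ∂leb01 := by
      conv_lhs => rw [← hmp.map_eq]
      rw [integral_map hmp.measurable.aemeasurable hmeas.aestronglyMeasurable]
      congr 1 with x
      rw [rademacher_bitFlip_self, rademacher_bitFlip_of_ne hij.ne, mul_neg]
    rw [integral_neg] at h
    simp only [Nat.succ_eq_add_one]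
    linarith
  split_ifs with h
  · subst h
    simp [rademacher_mul_self]
  · rcases Ne.lt_or_gt h with h | h
    · exact key h
    · simpa only [mul_comm] using key h

lemma map_eq_of_tendsto_of_measurePreserving {Ω : Type*} [MeasurableSpace Ω]
    [TopologicalSpace Ω] [TopologicalSpace.PseudoMetrizableSpace Ω] [BorelSpace Ω]
    {μ : Measure Ω} [IsFiniteMeasure μ] {F : ℕ → Ω → Ω} {f : Ω → Ω}
    (hF : ∀ N, MeasurePreserving (F N) μ μ) (hf : AEMeasurable f μ)
    (hlim : ∀ᵐ x ∂μ, Tendsto (fun N => F N x) atTop (𝓝 (f x))) :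
    μ.map f = μ := by
  refine ext_of_forall_integral_eq_of_IsFiniteMeasure fun u => ?_
  rw [integral_map hf u.continuous.measurable.aestronglyMeasurable]
  have h : Tendsto (fun N => ∫ x, u (F N x) ∂μ) atTop (𝓝 (∫ x, u (f x) ∂μ)) := by
    refine tendsto_integral_of_dominated_convergence (fun _ => ‖u‖)
      (fun N => (u.continuous.measurable.comp (hF N).measurable).aestronglyMeasurable)
      (integrable_const _) (fun N => ae_of_all _ fun x => u.norm_coe_le_norm _) ?_
    filter_upwards [hlim] with x hx
    exact (u.continuous.tendsto _).comp hx
  refine tendsto_nhds_unique h ?_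
  convert! tendsto_const_nhds using 2 with N
  conv_rhs => rw [← (hF N).map_eq]
  rw [integral_map (hF N).measurable.aemeasurable u.continuous.measurable.aestronglyMeasurable]

/-- Flip the `k`-th binary digit for every `k < N` with `d k = 1`. -/
def flipDigits (d : ℕ → ℕ) : ℕ → ℝ → ℝ
  | 0, x => x
  | N + 1, x => if d N = 1 then flipDigits d N (bitFlip N x) else flipDigits d N x

lemma measurePreserving_flipDigits (d : ℕ → ℕ) (N : ℕ) :
    MeasurePreserving (flipDigits d N) leb01 leb01 := by
  induction N with
  | zero => exact MeasurePreserving.id leb01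
  | succ N ih =>
    by_cases h : d N = 1
    · have hfun : flipDigits d (N + 1) = flipDigits d N ∘ bitFlip N := by
        ext x
        simp [flipDigits, h]
      rw [hfun]
      exact ih.comp (measurePreserving_bitFlip_leb01 N)
    · have hfun : flipDigits d (N + 1) = flipDigits d N := by
        ext x
        simp [flipDigits, h]
      rwa [hfun]

lemma flipDigits_eq_add_sum {d : ℕ → ℕ} (hd : ∀ k, d k < 2) (N : ℕ) (x : ℝ) :
    flipDigits d N x =
      x + ∑ k ∈ Finset.range N, d k * rademacher (k + 1) x / 2 ^ (k + 1) := by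
  induction N generalizing x with
  | zero => simp [flipDigits]
  | succ N ih =>
    rw [Finset.sum_range_succ, flipDigits]
    split_ifs with h
    · rw [ih, h]
      have hsum : ∀ k ∈ Finset.range N,
          d k * rademacher (k + 1) (bitFlip N x) / 2 ^ (k + 1) =
            d k * rademacher (k + 1) x / 2 ^ (k + 1) := by
        intro k hk
        rw [rademacher_bitFlip_of_ne (by have := Finset.mem_range.mp hk; omega)]
      rw [Finset.sum_congr rfl hsum, bitFlip]
      push_cast
      ring
    · have h₀ : d N = 0 := by have := hd N; omega
      rw [ih, h₀]
      simp

lemma rademacher_zero_flipDigits (d : ℕ → ℕ) (N : ℕ) (x : ℝ) :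
    rademacher 0 (flipDigits d N x) = rademacher 0 x := by
  induction N generalizing x with
  | zero => rfl
  | succ N ih =>
    rw [flipDigits]
    split_ifs
    · rw [ih, rademacher_bitFlip_of_ne (by omega)]
    · exact ih x

lemma rademacher_succ_flipDigits {d : ℕ → ℕ} (hd : ∀ k, d k < 2) (j N : ℕ) (x : ℝ) :
    rademacher (j + 1) (flipDigits d N x) =
      (if j < N then (-1) ^ d j else 1) * rademacher (j + 1) x := by
  induction N generalizing x with
  | zero => simp [flipDigits]
  | succ N ih =>
    rw [flipDigits]
    have hN := hd N
    rcases lt_trichotomy j N with h | rfl | h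
    · rw [if_pos (show j < N + 1 by omega)]
      split_ifs with h'
      · rw [ih, if_pos h, rademacher_bitFlip_of_ne (by omega)]
      · rw [ih, if_pos h]
    · rw [if_pos (Nat.lt_succ_self j)]
      split_ifs with h'
      · rw [ih, if_neg (lt_irrefl j), rademacher_bitFlip_self, h']
        ring
      · rw [ih, if_neg (lt_irrefl j), show d j = 0 by omega, pow_zero]
    · rw [if_neg (show ¬j < N + 1 by omega)]
      split_ifs with h'
      · rw [ih, if_neg (by omega), rademacher_bitFlip_of_ne (by omega)]
      · rw [ih, if_neg (by omega)]

lemma dyadicDigit_lt_two (x : ℝ) (k : ℕ) : dyadicDigit x k < 2 := by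
  unfold dyadicDigit
  split_ifs
  · norm_num
  · exact Nat.mod_lt _ two_pos

lemma rademacher_succ_eq_one_sub_dyadicDigit {x : ℝ} (hx : x ∈ Ico (0 : ℝ) 1) (k : ℕ) :
    rademacher (k + 1) x = 1 - 2 * dyadicDigit x k := by
  have hfl : 0 ≤ ⌊2 ^ (k + 1) * x⌋ := Int.floor_nonneg.mpr (mul_nonneg (by positivity) hx.1)
  rw [dyadicDigit, if_neg hx.2.ne, rademacher]
  obtain ⟨q, hq⟩ := Int.eq_ofNat_of_zero_le hfl
  rw [hq, Int.toNat_natCast, zpow_natCast, neg_one_pow_eq_pow_mod_two]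
  rcases Nat.mod_two_eq_zero_or_one q with h | h <;> rw [h] <;> norm_num

lemma sum_range_dyadicDigit {x : ℝ} (hx : x ∈ Ico (0 : ℝ) 1) (N : ℕ) :
    ∑ k ∈ Finset.range N, (dyadicDigit x k : ℝ) / 2 ^ (k + 1) = ⌊x * 2 ^ N⌋₊ / 2 ^ N := by
  induction N with
  | zero =>
    simp [Nat.floor_eq_zero.mpr hx.2]
  | succ N ih =>
    have h : ⌊x * 2 ^ N⌋₊ = ⌊x * 2 ^ (N + 1)⌋₊ / 2 := by
      rw [← Nat.floor_div_ofNat]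
      congr 1
      rw [pow_succ]
      ring
    have hdig : dyadicDigit x N = ⌊x * 2 ^ (N + 1)⌋₊ % 2 := by
      rw [dyadicDigit, if_neg hx.2.ne, Int.floor_toNat, mul_comm]
    rw [Finset.sum_range_succ, ih, hdig, h]
    have hdiv := Nat.div_add_mod ⌊x * 2 ^ (N + 1)⌋₊ 2
    have hcast : (⌊x * 2 ^ (N + 1)⌋₊ : ℝ) =
        2 * (⌊x * 2 ^ (N + 1)⌋₊ / 2 : ℕ) + (⌊x * 2 ^ (N + 1)⌋₊ % 2 : ℕ) := by
      exact_mod_cast hdiv.symm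
    rw [hcast, pow_succ]
    field_simp

lemma tendsto_flipDigits_dyadicAdd {x : ℝ} (hx : x ∈ Ico (0 : ℝ) 1) (g : ℝ) :
    Tendsto (fun N => flipDigits (dyadicDigit g) N x) atTop (𝓝 (dyadicAdd x g)) := by
  have hterm : ∀ k, |(dyadicDigit x k : ℝ) - dyadicDigit g k| / 2 ^ (k + 1) =
      dyadicDigit x k / 2 ^ (k + 1) +
        dyadicDigit g k * rademacher (k + 1) x / 2 ^ (k + 1) := by
    intro k
    rw [rademacher_succ_eq_one_sub_dyadicDigit hx, ← add_div]
    congr 1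
    have h₁ := dyadicDigit_lt_two x k
    have h₂ := dyadicDigit_lt_two g k
    interval_cases dyadicDigit x k <;> interval_cases dyadicDigit g k <;> norm_num
  have hsummable : Summable fun k : ℕ =>
      |(dyadicDigit x k : ℝ) - dyadicDigit g k| / 2 ^ (k + 1) := by
    refine Summable.of_nonneg_of_le (fun k => by positivity) (fun k => ?_)
      ((summable_geometric_two).mul_right (1 / 2))
    rw [← pow_succ, one_div_pow]
    gcongr
    have h₁ := dyadicDigit_lt_two x k
    have h₂ := dyadicDigit_lt_two g k
    interval_cases dyadicDigit x k <;> interval_cases dyadicDigit g k <;> norm_num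
  have h₁ := hsummable.hasSum.tendsto_sum_nat
  have h₂ : Tendsto (fun N : ℕ => (⌊x * 2 ^ N⌋₊ : ℝ) / 2 ^ N) atTop (𝓝 x) :=
    (tendsto_nat_floor_mul_div_atTop hx.1).comp
      (tendsto_pow_atTop_atTop_of_one_lt (one_lt_two : (1 : ℝ) < 2))
  have h₃ := (h₁.sub h₂).add_const x
  rw [sub_add_cancel] at h₃
  refine h₃.congr fun N => ?_
  rw [flipDigits_eq_add_sum (dyadicDigit_lt_two g), Finset.sum_congr rfl fun k _ => hterm k,
    Finset.sum_add_distrib, sum_range_dyadicDigit hx]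
  ring

lemma ae_tendsto_flipDigits_dyadicAdd (g : ℝ) : ∀ᵐ x ∂leb01,
    Tendsto (fun N => flipDigits (dyadicDigit g) N x) atTop (𝓝 (dyadicAdd x g)) := by
  filter_upwards [ae_leb01_mem_Ico] with x hx using tendsto_flipDigits_dyadicAdd hx g

lemma aemeasurable_dyadicAdd (g : ℝ) : AEMeasurable (fun x => dyadicAdd x g) leb01 :=
  aemeasurable_of_tendsto_metrizable_ae atTop
    (fun N => (measurePreserving_flipDigits (dyadicDigit g) N).measurable.aemeasurable)
    (ae_tendsto_flipDigits_dyadicAdd g)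

lemma map_dyadicAdd_leb01 (g : ℝ) : leb01.map (fun x => dyadicAdd x g) = leb01 :=
  map_eq_of_tendsto_of_measurePreserving (measurePreserving_flipDigits (dyadicDigit g))
    (aemeasurable_dyadicAdd g) (ae_tendsto_flipDigits_dyadicAdd g)

lemma ae_dyadicAdd {q : ℝ → Prop} (hq : ∀ᵐ y ∂leb01, q y) (g : ℝ) :
    ∀ᵐ x ∂leb01, q (dyadicAdd x g) := by
  rw [← map_dyadicAdd_leb01 g] at hq
  exact ae_of_ae_map (aemeasurable_dyadicAdd g) hq

lemma ae_continuousAt_rademacher (j : ℕ) : ∀ᵐ y ∂leb01, ContinuousAt (rademacher j) y := by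
  have hc : (range fun z : ℤ => (z : ℝ) / 2 ^ j).Countable := countable_range _
  filter_upwards [hc.ae_notMem leb01] with y hy
  have hne : ∀ z : ℤ, (2 : ℝ) ^ j * y ≠ z := by
    rintro z hz
    exact hy ⟨z, by simp only [← hz]; field_simp⟩
  have hev : ∀ᶠ w in 𝓝 y, ⌊(2 : ℝ) ^ j * w⌋ = ⌊2 ^ j * y⌋ := by
    have hcont : ContinuousAt (fun w : ℝ => 2 ^ j * w) y := by fun_prop
    have hmem : Ioo (⌊2 ^ j * y⌋ : ℝ) (⌊2 ^ j * y⌋ + 1) ∈ 𝓝 ((2 : ℝ) ^ j * y) :=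
      Ioo_mem_nhds ((Int.floor_le _).lt_of_ne (hne _).symm) (Int.lt_floor_add_one _)
    filter_upwards [hcont hmem] with w hw
    exact Int.floor_eq_iff.mpr ⟨hw.1.le, hw.2⟩
  refine ContinuousAt.congr (f := fun _ => rademacher j y) continuousAt_const ?_
  filter_upwards [hev] with w hw
  rw [rademacher, rademacher, hw]

/-- The eigenvalue of the dyadic translation by `g` on the `j`-th Rademacher function. -/
def translationSign (g : ℝ) : ℕ → ℝ
  | 0 => 1
  | j + 1 => (-1) ^ dyadicDigit g j

lemma ae_rademacher_dyadicAdd (g : ℝ) (j : ℕ) :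
    ∀ᵐ x ∂leb01, rademacher j (dyadicAdd x g) = translationSign g j * rademacher j x := by
  filter_upwards [ae_dyadicAdd (ae_continuousAt_rademacher j) g,
    ae_tendsto_flipDigits_dyadicAdd g] with x hcont hlim
  refine tendsto_nhds_unique (hcont.tendsto.comp hlim) (tendsto_const_nhds.congr' ?_)
  filter_upwards [eventually_ge_atTop j] with N hN
  cases j with
  | zero => simp [translationSign, rademacher_zero_flipDigits]
  | succ j =>
    simp [translationSign, rademacher_succ_flipDigits (dyadicDigit_lt_two g), Nat.lt_of_succ_le hN]

lemma translationSign_eq_rademacher {g : ℝ} (hg : g ∈ Ico (0 : ℝ) 1) (j : ℕ) :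
    translationSign g j = rademacher j g := by
  cases j with
  | zero => simp [translationSign, rademacher, Int.floor_eq_zero_iff.mpr hg]
  | succ j =>
    rw [translationSign, rademacher_succ_eq_one_sub_dyadicDigit hg]
    have h := dyadicDigit_lt_two g j
    interval_cases dyadicDigit g j <;> norm_num

lemma one_div_two_pow_sub_mem_Ico {m n : ℕ} (hmn : n < m) :
    (1 / 2 ^ n - 1 / 2 ^ m : ℝ) ∈ Ico (0 : ℝ) 1 := by
  have h₁ : (1 : ℝ) / 2 ^ m ≤ 1 / 2 ^ n :=
    one_div_le_one_div_of_le (by positivity) (pow_le_pow_right₀ one_le_two hmn.le)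
  have h₂ : (0 : ℝ) < 1 / 2 ^ m := by positivity
  have h₃ : (1 : ℝ) / 2 ^ n ≤ 1 := (div_le_one₀ (by positivity)).mpr (one_le_pow₀ one_le_two)
  constructor <;> linarith

lemma translationSign_of_le {m n j : ℕ} (hmn : n < m) (hj : j ≤ n) :
    translationSign (1 / 2 ^ n - 1 / 2 ^ m) j = 1 := by
  have hg := one_div_two_pow_sub_mem_Ico hmn
  have hfl : ⌊(2 : ℝ) ^ j * (1 / 2 ^ n - 1 / 2 ^ m)⌋ = 0 := by
    refine Int.floor_eq_zero_iff.mpr ⟨mul_nonneg (by positivity) hg.1, ?_⟩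
    have h₁ : (2 : ℝ) ^ j * (1 / 2 ^ n) ≤ 1 := by
      rw [mul_one_div]
      exact (div_le_one₀ (by positivity)).mpr (pow_le_pow_right₀ one_le_two hj)
    have h₂ : (0 : ℝ) < 2 ^ j * (1 / 2 ^ m) := by positivity
    linarith
  rw [translationSign_eq_rademacher hg, rademacher, hfl, zpow_zero]

lemma translationSign_of_gt {m n j : ℕ} (hj : n < j) (hjm : j ≤ m) :
    translationSign (1 / 2 ^ n - 1 / 2 ^ m) j = -1 := by
  obtain ⟨l, rfl⟩ := Nat.exists_eq_add_of_lt hj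
  have hfl : ⌊(2 : ℝ) ^ (n + l + 1) * (1 / 2 ^ n - 1 / 2 ^ m)⌋ = 2 * (2 ^ l - 1) + 1 := by
    have h₁ : (2 : ℝ) ^ (n + l + 1) * (1 / 2 ^ n) = 2 * 2 ^ l := by
      field_simp
      ring
    have h₂ : (2 : ℝ) ^ (n + l + 1) * (1 / 2 ^ m) ≤ 1 := by
      rw [mul_one_div]
      exact (div_le_one₀ (by positivity)).mpr (pow_le_pow_right₀ one_le_two hjm)
    have h₃ : (0 : ℝ) < 2 ^ (n + l + 1) * (1 / 2 ^ m) := by positivity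
    rw [Int.floor_eq_iff, mul_sub ((2 : ℝ) ^ (n + l + 1)), h₁]
    push_cast
    constructor <;> linarith
  rw [translationSign_eq_rademacher (one_div_two_pow_sub_mem_Ico (by omega)), rademacher, hfl,
    (odd_two_mul_add_one _).neg_one_zpow]

lemma linearMap_ext_span {R V W : Type*} [Semiring R] [AddCommMonoid V] [AddCommMonoid W]
    [Module R V] [Module R W] {s : Set V} {L₁ L₂ : Submodule.span R s →ₗ[R] W}
    (h : ∀ x (hx : x ∈ s), L₁ ⟨x, Submodule.subset_span hx⟩ = L₂ ⟨x, Submodule.subset_span hx⟩) :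
    L₁ = L₂ := by
  ext ⟨x, hx⟩
  induction hx using Submodule.span_induction with
  | mem x hx => exact h x hx
  | zero => exact (map_zero L₁).trans (map_zero L₂).symm
  | add x y hx hy ihx ihy =>
    exact (map_add L₁ ⟨x, hx⟩ ⟨y, hy⟩).trans
      ((congrArg₂ (· + ·) ihx ihy).trans (map_add L₂ ⟨x, hx⟩ ⟨y, hy⟩).symm)
  | smul a x hx ih =>
    exact (map_smul L₁ a ⟨x, hx⟩).trans
      ((congrArg (a • ·) ih).trans (map_smul L₂ a ⟨x, hx⟩).symm)

lemma opNormLp_le_one {p : ℝ≥0∞} {S : Submodule ℝ (Lp01 p)} {L : S →ₗ[ℝ] S}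
    (hL : ∀ f : S, ‖(L f : Lp01 p)‖ ≤ ‖(f : Lp01 p)‖) : opNormLp S L ≤ 1 := by
  refine Real.sSup_le ?_ zero_le_one
  rintro s ⟨f, hf, rfl⟩
  exact (hL f).trans hf

lemma one_le_opNormLp {p : ℝ≥0∞} [Fact (1 ≤ p)] {S : Submodule ℝ (Lp01 p)}
    [FiniteDimensional ℝ S] {L : S →ₗ[ℝ] S} {v : S} (hv : v ≠ 0) (hL : L v = v) :
    1 ≤ opNormLp S L := by
  have hnorm : ‖v‖ ≠ 0 := norm_ne_zero_iff.mpr hv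
  have hunit : ‖(‖v‖⁻¹ • v : S)‖ = 1 := by
    rw [norm_smul, norm_inv, norm_norm, inv_mul_cancel₀ hnorm]
  refine le_csSup ⟨‖LinearMap.toContinuousLinearMap L‖, ?_⟩
    ⟨‖v‖⁻¹ • v, hunit.le, ?_⟩
  · rintro s ⟨f, hf, rfl⟩
    exact (LinearMap.toContinuousLinearMap L).unit_le_opNorm f hf
  · rw [map_smul, hL]
    exact hunit.symm

/-- Let `1 ≤ p < ∞` and `m > n`, let `r_j` be the Rademacher functions regarded as elements
of `L^p[0,1]` and `Rad_k = span(r_0, …, r_k)`, and let `T_g` (`g ∈ [0,1]`) be the dyadic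
translations `(T_g f)(x) = f(x ⊕ g)`, which are surjective linear isometries of `L^p[0,1]`
mapping each `Rad_k` into itself. Then the Rademacher projection
`R_n f = ∑_{j=0}^n (∫_0^1 f(t) r_j(t) dt) r_j` is the unique linear projection of `Rad_m`
onto `Rad_n` commuting with all the `T_g`, and it is minimal with respect to the `L^p`
operator norm: `‖R_n‖_p ≤ ‖P‖_p` for every linear projection `P` of `Rad_m` onto `Rad_n`. -/
theorem rademacher_projection_unique_commuting_minimal
    (p : ℝ≥0∞) (hp₁ : 1 ≤ p) (hp₂ : p ≠ ⊤) (m n : ℕ) (hmn : n < m)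
    -- the Rademacher functions as elements of `L^p[0,1]`:
    (r : ℕ → Lp01 p) (hr : ∀ j : ℕ, (r j : ℝ → ℝ) =ᵐ[leb01] rademacher j)
    -- the dyadic translations, surjective linear isometries of `L^p[0,1]`:
    (T : ℝ → (Lp01 p →ₗ[ℝ] Lp01 p))
    (hT : ∀ g ∈ Set.Icc (0 : ℝ) 1, ∀ f : Lp01 p,
      (T g f : ℝ → ℝ) =ᵐ[leb01] fun x => (f : ℝ → ℝ) (dyadicAdd x g))
    (hTiso : ∀ g ∈ Set.Icc (0 : ℝ) 1, ∀ f : Lp01 p, ‖T g f‖ = ‖f‖)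
    (hTsurj : ∀ g ∈ Set.Icc (0 : ℝ) 1, Function.Surjective (T g))
    (hTRad : ∀ g ∈ Set.Icc (0 : ℝ) 1, ∀ (k : ℕ),
      ∀ f ∈ Submodule.span ℝ (r '' Set.Iic k), T g f ∈ Submodule.span ℝ (r '' Set.Iic k))
    -- `Rad_m` and `Rad_n`:
    (Radm Radn : Submodule ℝ (Lp01 p))
    (hRadm : Radm = Submodule.span ℝ (r '' Set.Iic m))
    (hRadn : Radn = Submodule.span ℝ (r '' Set.Iic n))
    -- the Rademacher projection `R_n`:
    (Rn : ↥Radm →ₗ[ℝ] ↥Radm)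
    (hRn : ∀ f : ↥Radm, (Rn f : Lp01 p) =
      ∑ j ∈ Finset.range (n + 1),
        (∫ t, ((f : Lp01 p) : ℝ → ℝ) t * rademacher j t ∂leb01) • r j) :
    -- `R_n` is a projection of `Rad_m` onto `Rad_n` commuting with the dyadic translations,
    (∀ f : ↥Radm, (Rn f : Lp01 p) ∈ Radn) ∧
    (∀ v : ↥Radm, (v : Lp01 p) ∈ Radn → Rn v = v) ∧
    (∀ g ∈ Set.Icc (0 : ℝ) 1, ∀ (f : ↥Radm) (h : T g ↑f ∈ Radm),
      (Rn ⟨T g ↑f, h⟩ : Lp01 p) = T g ↑(Rn f)) ∧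
    -- it is the unique such projection,
    (∀ P : ↥Radm →ₗ[ℝ] ↥Radm, (∀ f : ↥Radm, (P f : Lp01 p) ∈ Radn) →
      (∀ v : ↥Radm, (v : Lp01 p) ∈ Radn → P v = v) →
      (∀ g ∈ Set.Icc (0 : ℝ) 1, ∀ (f : ↥Radm) (h : T g ↑f ∈ Radm),
        (P ⟨T g ↑f, h⟩ : Lp01 p) = T g ↑(P f)) → P = Rn) ∧
    -- and it is minimal among all projections of `Rad_m` onto `Rad_n`:
    (∀ P : ↥Radm →ₗ[ℝ] ↥Radm, (∀ f : ↥Radm, (P f : Lp01 p) ∈ Radn) →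
      (∀ v : ↥Radm, (v : Lp01 p) ∈ Radn → P v = v) →
      opNormLp Radm Rn ≤ opNormLp Radm P) := by
  have : Fact (1 ≤ p) := ⟨hp₁⟩
  subst hRadm hRadn
  have hmem : ∀ {j k : ℕ}, j ≤ k → r j ∈ Submodule.span ℝ (r '' Iic k) := fun hjk =>
    Submodule.subset_span (mem_image_of_mem r hjk)
  have hTr : ∀ g ∈ Icc (0 : ℝ) 1, ∀ j, T g (r j) = translationSign g j • r j := by
    intro g hg j
    refine Lp.ext ?_
    filter_upwards [hT g hg (r j), Lp.coeFn_smul (translationSign g j) (r j), hr j,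
      ae_dyadicAdd (hr j) g, ae_rademacher_dyadicAdd g j] with x h₁ h₂ h₃ h₄ h₅
    rw [h₁, h₂, h₄, h₅, Pi.smul_apply, h₃, smul_eq_mul]
  have hint : ∀ i j, ∫ t, (r i : ℝ → ℝ) t * rademacher j t ∂leb01 = if i = j then 1 else 0 := by
    intro i j
    rw [← integral_rademacher_mul]
    refine integral_congr_ae ?_
    filter_upwards [hr i] with t ht
    rw [ht]
  have hRnr : ∀ (j : ℕ) (hj : r j ∈ Submodule.span ℝ (r '' Iic m)),
      (Rn ⟨r j, hj⟩ : Lp01 p) = if j ≤ n then r j else 0 := by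
    intro j hj
    simp [hRn, hint, ite_smul]
  have hRange : ∀ f, (Rn f : Lp01 p) ∈ Submodule.span ℝ (r '' Iic n) := fun f => by
    rw [hRn]
    exact Submodule.sum_mem _ fun j hj =>
      Submodule.smul_mem _ _ (hmem (Nat.lt_succ_iff.mp (Finset.mem_range.mp hj)))
  have hle : Submodule.span ℝ (r '' Iic n) ≤ Submodule.span ℝ (r '' Iic m) :=
    Submodule.span_mono (image_mono (Iic_subset_Iic.mpr hmn.le))
  have hRnfix : ∀ v : Submodule.span ℝ (r '' Iic m),
      (v : Lp01 p) ∈ Submodule.span ℝ (r '' Iic n) → Rn v = v := by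
    intro v hv
    have h : Rn ∘ₗ Submodule.inclusion hle = Submodule.inclusion hle := by
      refine linearMap_ext_span ?_
      rintro _ ⟨j, hj, rfl⟩
      refine Subtype.ext ((hRnr j (hmem (le_trans hj hmn.le))).trans ?_)
      exact if_pos hj
    exact LinearMap.congr_fun h ⟨v, hv⟩
  set g : ℝ := 1 / 2 ^ n - 1 / 2 ^ m with hg_def
  have hg : g ∈ Icc (0 : ℝ) 1 := Ico_subset_Icc_self (one_div_two_pow_sub_mem_Ico hmn)
  have hTfix : ∀ v ∈ Submodule.span ℝ (r '' Iic n), T g v = v := by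
    intro v hv
    have h : T g ∘ₗ (Submodule.span ℝ (r '' Iic n)).subtype =
        (Submodule.span ℝ (r '' Iic n)).subtype := by
      refine linearMap_ext_span ?_
      rintro _ ⟨j, hj, rfl⟩
      change T g (r j) = r j
      rw [hTr g hg, translationSign_of_le hmn hj, one_smul]
    exact LinearMap.congr_fun h ⟨v, hv⟩
  have hTneg : ∀ j, n < j → j ≤ m → T g (r j) = -r j := by
    intro j hj hjm
    rw [hTr g hg, translationSign_of_gt hj hjm, neg_one_smul]
  refine ⟨hRange, hRnfix, ?_, ?_, ?_⟩
  · intro g' hg' f h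
    have hcomm : (Submodule.span ℝ (r '' Iic m)).subtype ∘ₗ Rn ∘ₗ
        (T g').restrict (hTRad g' hg' m) =
          T g' ∘ₗ (Submodule.span ℝ (r '' Iic m)).subtype ∘ₗ Rn := by
      refine linearMap_ext_span ?_
      rintro _ ⟨j, hj, rfl⟩
      have hj' := hmem (show j ≤ m from hj)
      have hsub : (T g').restrict (hTRad g' hg' m) ⟨r j, hj'⟩ =
          translationSign g' j • ⟨r j, hj'⟩ := Subtype.ext (hTr g' hg' j)
      simp only [LinearMap.comp_apply, hsub, map_smul, Submodule.subtype_apply, hRnr]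
      split_ifs
      · rw [hTr g' hg']
      · rw [smul_zero, map_zero]
    exact LinearMap.congr_fun hcomm f
  · intro P hPrange hPfix hPcomm
    refine linearMap_ext_span ?_
    rintro _ ⟨j, hj, rfl⟩
    have hj' := hmem (show j ≤ m from hj)
    rcases le_or_gt j n with hjn | hjn
    · rw [hPfix ⟨r j, hj'⟩ (hmem hjn), hRnfix ⟨r j, hj'⟩ (hmem hjn)]
    · refine Subtype.ext ?_
      rw [hRnr, if_neg hjn.not_ge]
      have h := hPcomm g hg ⟨r j, hj'⟩ (hTRad g hg m _ hj')
      have hsub : (⟨T g (r j), hTRad g hg m _ hj'⟩ : Submodule.span ℝ (r '' Iic m)) =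
          -⟨r j, hj'⟩ := Subtype.ext (hTneg j hjn hj)
      rw [hsub, map_neg, hTfix _ (hPrange _)] at h
      have h' : (2 : ℝ) • (P ⟨r j, hj'⟩ : Lp01 p) = 0 := by
        rw [two_smul]
        exact eq_neg_iff_add_eq_zero.mp h.symm
      exact (smul_eq_zero.mp h').resolve_left two_ne_zero
  · intro P _ hPfix
    have hdouble : (2 : ℝ) • ((Submodule.span ℝ (r '' Iic m)).subtype ∘ₗ Rn) =
        (Submodule.span ℝ (r '' Iic m)).subtype +
          T g ∘ₗ (Submodule.span ℝ (r '' Iic m)).subtype := by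
      refine linearMap_ext_span ?_
      rintro _ ⟨j, hj, rfl⟩
      simp only [LinearMap.smul_apply, LinearMap.add_apply, LinearMap.comp_apply,
        Submodule.subtype_apply, hRnr]
      split_ifs with hjn
      · rw [hTfix _ (hmem hjn), two_smul]
      · rw [hTneg j (not_le.mp hjn) hj, smul_zero, add_neg_cancel]
    have hcontract : ∀ f, ‖(Rn f : Lp01 p)‖ ≤ ‖(f : Lp01 p)‖ := by
      intro f
      have h : (2 : ℝ) • (Rn f : Lp01 p) = f + T g f := LinearMap.congr_fun hdouble f
      have h' := norm_add_le (f : Lp01 p) (T g f)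
      rw [← h, hTiso g hg, norm_smul, Real.norm_ofNat] at h'
      linarith
    have : FiniteDimensional ℝ (Submodule.span ℝ (r '' Iic m)) :=
      FiniteDimensional.span_of_finite ℝ ((finite_Iic m).image r)
    have hne : (⟨r 0, hmem m.zero_le⟩ : Submodule.span ℝ (r '' Iic m)) ≠ 0 := by
      intro h
      have h₀ : r 0 = 0 := congrArg Subtype.val h
      simpa [h₀] using hint 0 0
    exact (opNormLp_le_one hcontract).trans
      (one_le_opNormLp hne (hPfix _ (hmem n.zero_le)))
end
end

section
/- Let ‖·‖ be a symmetric norm on ℝ^n, i.e. ‖Σ_{j=1}^n a_j e_j‖ = ‖Σ_{j=1}^n ε_j a_{σ(j)} e_j‖ for all scalars a_1, ..., a_n, all signs ε_j ∈ {−1, 1}, and all permutations σ of {1, ..., n}, where (e_j) is the standard basis. Let X_n be the space of linear operators on ℝ^n equipped with the operator norm induced by ‖·‖, and let Y_n = {L ∈ X_n : L = L^T} be the subspace of symmetric operators. Then the map P defined by P(L) = (L + L^T)/2 is a minimal projection of X_n onto Y_n: ‖P‖ ≤ ‖P'‖ for every linear projection P' of X_n onto Y_n, where these norms are operator norms on operators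 of X_n induced by the operator norm of X_n. -/
open Matrix

noncomputable section

/-- The transpose of a linear operator on `ℝⁿ` with respect to the standard basis. -/
def transposeOp {n : ℕ} (L : (Fin n → ℝ) →ₗ[ℝ] (Fin n → ℝ)) :
    (Fin n → ℝ) →ₗ[ℝ] (Fin n → ℝ) :=
  Matrix.toLin' (LinearMap.toMatrix' L)ᵀ

/-- `Y_n`: the subspace of symmetric operators `L = Lᵀ` on `ℝⁿ`. -/
def symOps (n : ℕ) : Submodule ℝ ((Fin n → ℝ) →ₗ[ℝ] (Fin n → ℝ)) where
  carrier := {L | transposeOp L = L}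
  add_mem' := fun hA hB => by
    simp only [Set.mem_setOf_eq, transposeOp, map_add, Matrix.transpose_add] at *
    rw [hA, hB]
  zero_mem' := by simp [transposeOp]
  smul_mem' := fun c L hL => by
    simp only [Set.mem_setOf_eq, transposeOp] at *
    rw [_root_.map_smul, Matrix.transpose_smul, _root_.map_smul, hL]

/-- The operator norm on operators of `ℝⁿ` induced by a norm-function `N` on `ℝⁿ`:
`sup { N (L v) : N v ≤ 1 }`. -/
def opNormVec {n : ℕ} (N : (Fin n → ℝ) → ℝ) (L : (Fin n → ℝ) →ₗ[ℝ] (Fin n → ℝ)) : ℝ :=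
  sSup {s : ℝ | ∃ v : Fin n → ℝ, N v ≤ 1 ∧ s = N (L v)}

/-- The norm, induced by the operator norm `opNormVec N` of `X_n`, of a linear map on
`X_n = L(ℝⁿ)`. -/
def opNormOp {n : ℕ} (N : (Fin n → ℝ) → ℝ)
    (P : ((Fin n → ℝ) →ₗ[ℝ] (Fin n → ℝ)) →ₗ[ℝ] ((Fin n → ℝ) →ₗ[ℝ] (Fin n → ℝ))) : ℝ :=
  sSup {s : ℝ | ∃ L : (Fin n → ℝ) →ₗ[ℝ] (Fin n → ℝ), opNormVec N L ≤ 1 ∧ s = opNormVec N (P L)}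

section SignedPermutations

variable {n : ℕ}

/-- The conjugate of the matrix `M` by the signed permutation
`v ↦ (j ↦ ε j * v (σ j))`. -/
def signedConj (ε : Fin n → ℤˣ) (σ : Equiv.Perm (Fin n)) :
    Matrix (Fin n) (Fin n) ℝ →ₗ[ℝ] Matrix (Fin n) (Fin n) ℝ where
  toFun M := Matrix.of fun i j => ((ε i * ε j : ℤˣ) : ℝ) * M (σ i) (σ j)
  map_add' A B := by ext i j; simp [mul_add]
  map_smul' c A := by ext i j; simp [mul_left_comm]

lemma signedConj_apply (ε : Fin n → ℤˣ) (σ : Equiv.Perm (Fin n))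
    (M : Matrix (Fin n) (Fin n) ℝ) (i j : Fin n) :
    signedConj ε σ M i j = ((ε i * ε j : ℤˣ) : ℝ) * M (σ i) (σ j) := rfl

lemma transpose_signedConj (ε : Fin n → ℤˣ) (σ : Equiv.Perm (Fin n))
    (M : Matrix (Fin n) (Fin n) ℝ) : (signedConj ε σ M)ᵀ = signedConj ε σ Mᵀ := by
  ext i j
  simp [signedConj_apply, mul_comm (ε j : ℤˣ)]

lemma signedConj_symm_signedConj (ε : Fin n → ℤˣ) (σ : Equiv.Perm (Fin n))
    (M : Matrix (Fin n) (Fin n) ℝ) :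
    signedConj (ε ∘ σ.symm) σ.symm (signedConj ε σ M) = M := by
  ext i j
  simp only [signedConj_apply, Function.comp_apply, Equiv.apply_symm_apply, ← mul_assoc]
  rcases Int.units_eq_one_or (ε (σ.symm i)) with h | h <;>
    rcases Int.units_eq_one_or (ε (σ.symm j)) with h' | h' <;> simp [h, h']

lemma signedConj_sign (ε δ : Fin n → ℤˣ) (σ : Equiv.Perm (Fin n))
    (M : Matrix (Fin n) (Fin n) ℝ) :
    signedConj ε σ (signedConj δ 1 M) = signedConj (ε * (δ ∘ σ)) σ M := by
  ext i j
  simp [signedConj_apply]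
  ring

lemma signedConj_perm (ε : Fin n → ℤˣ) (σ τ : Equiv.Perm (Fin n))
    (M : Matrix (Fin n) (Fin n) ℝ) :
    signedConj ε σ (signedConj 1 τ M) = signedConj ε (τ * σ) M := by
  ext i j
  simp [signedConj_apply]

/-- The sum of the conjugates of `Q` by all signed permutations. -/
def signedSum (Q : Matrix (Fin n) (Fin n) ℝ →ₗ[ℝ] Matrix (Fin n) (Fin n) ℝ) :
    Matrix (Fin n) (Fin n) ℝ →ₗ[ℝ] Matrix (Fin n) (Fin n) ℝ :=
  ∑ σ : Equiv.Perm (Fin n), ∑ ε : Fin n → ℤˣ,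
    signedConj (ε ∘ σ.symm) σ.symm ∘ₗ Q ∘ₗ signedConj ε σ

lemma signedSum_apply (Q : Matrix (Fin n) (Fin n) ℝ →ₗ[ℝ] Matrix (Fin n) (Fin n) ℝ)
    (M : Matrix (Fin n) (Fin n) ℝ) :
    signedSum Q M = ∑ σ : Equiv.Perm (Fin n), ∑ ε : Fin n → ℤˣ,
      signedConj (ε ∘ σ.symm) σ.symm (Q (signedConj ε σ M)) := by
  simp [signedSum, LinearMap.sum_apply]

lemma signedSum_sign (Q : Matrix (Fin n) (Fin n) ℝ →ₗ[ℝ] Matrix (Fin n) (Fin n) ℝ)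
    (δ : Fin n → ℤˣ) (M : Matrix (Fin n) (Fin n) ℝ) :
    signedSum Q (signedConj δ 1 M) = signedConj δ 1 (signedSum Q M) := by
  simp only [signedSum_apply, map_sum]
  refine Finset.sum_congr rfl fun σ _ => ?_
  refine Fintype.sum_equiv (Equiv.mulRight (δ ∘ σ)) _ _ fun ε => ?_
  rw [signedConj_sign, Equiv.coe_mulRight]
  ext i j
  simp only [signedConj_apply, Function.comp_apply, Pi.mul_apply, Equiv.apply_symm_apply,
    Equiv.Perm.one_apply]
  rcases Int.units_eq_one_or (δ i) with h | h <;>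
    rcases Int.units_eq_one_or (δ j) with h' | h' <;> simp [h, h']

lemma signedSum_perm (Q : Matrix (Fin n) (Fin n) ℝ →ₗ[ℝ] Matrix (Fin n) (Fin n) ℝ)
    (τ : Equiv.Perm (Fin n)) (M : Matrix (Fin n) (Fin n) ℝ) :
    signedSum Q (signedConj 1 τ M) = signedConj 1 τ (signedSum Q M) := by
  simp only [signedSum_apply, map_sum]
  refine Fintype.sum_equiv (Equiv.mulLeft τ) _ _ fun σ => ?_
  refine Finset.sum_congr rfl fun ε _ => ?_
  rw [signedConj_perm, Equiv.coe_mulLeft]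
  have h : ∀ i, (τ * σ).symm (τ i) = σ.symm i := fun i => by
    rw [Equiv.symm_apply_eq]; simp
  ext i j
  simp [signedConj_apply, h]

lemma transpose_signedSum {Q : Matrix (Fin n) (Fin n) ℝ →ₗ[ℝ] Matrix (Fin n) (Fin n) ℝ}
    (hQ : ∀ M, (Q M)ᵀ = Q M) (M : Matrix (Fin n) (Fin n) ℝ) :
    (signedSum Q M)ᵀ = signedSum Q M := by
  simp only [signedSum_apply, Matrix.transpose_sum, transpose_signedConj, hQ]

lemma signedSum_of_symm {Q : Matrix (Fin n) (Fin n) ℝ →ₗ[ℝ] Matrix (Fin n) (Fin n) ℝ}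
    (hQ : ∀ M, Mᵀ = M → Q M = M) {M : Matrix (Fin n) (Fin n) ℝ} (hM : Mᵀ = M) :
    signedSum Q M = (Fintype.card (Equiv.Perm (Fin n)) * Fintype.card (Fin n → ℤˣ) : ℝ) • M := by
  have h : ∀ ε σ, Q (signedConj ε σ M) = signedConj ε σ M := fun ε σ =>
    hQ _ (by rw [transpose_signedConj, hM])
  simp only [signedSum_apply, h, signedConj_symm_signedConj, Finset.sum_const, Finset.card_univ]
  rw [← Nat.cast_smul_eq_nsmul ℝ, ← Nat.cast_smul_eq_nsmul ℝ, smul_smul]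

lemma signedSum_single_sub_single
    {Q : Matrix (Fin n) (Fin n) ℝ →ₗ[ℝ] Matrix (Fin n) (Fin n) ℝ}
    (hQ : ∀ M, (Q M)ᵀ = Q M) (k l : Fin n) :
    signedSum Q (Matrix.single k l 1 - Matrix.single l k 1) = 0 := by
  rcases eq_or_ne k l with rfl | hkl
  · simp
  set A : Matrix (Fin n) (Fin n) ℝ := Matrix.single k l 1 - Matrix.single l k 1 with hA
  have hentry : ∀ i j, A i j = (if k = i ∧ l = j then 1 else 0) -
      if l = i ∧ k = j then 1 else 0 := fun i j => by
    rw [hA, Matrix.sub_apply, Matrix.single_apply, Matrix.single_apply]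
  clear_value A
  have hflip : ∀ m, m = k ∨ m = l →
      signedConj (fun i => if i = m then -1 else 1) 1 A = -A := by
    intro m hm
    ext i j
    rw [signedConj_apply, Matrix.neg_apply, Equiv.Perm.one_apply, Equiv.Perm.one_apply, hentry]
    by_cases h1 : k = i ∧ l = j
    · obtain ⟨rfl, rfl⟩ := h1
      rcases hm with rfl | rfl <;> simp [hkl, hkl.symm]
    by_cases h2 : l = i ∧ k = j
    · obtain ⟨rfl, rfl⟩ := h2
      rcases hm with rfl | rfl <;> simp [hkl, hkl.symm]
    simp [h1, h2]
  have hswap : signedConj 1 (Equiv.swap k l) A = -A := by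
    ext i j
    rw [signedConj_apply, Matrix.neg_apply, hentry, hentry]
    simp only [eq_comm (b := Equiv.swap k l _), Equiv.swap_apply_eq_iff, Equiv.swap_apply_left,
      Equiv.swap_apply_right, Pi.one_apply, mul_one, Units.val_one, Int.cast_one, one_mul,
      neg_sub, eq_comm (a := i), eq_comm (a := j)]
  have hsymm : ∀ i j, signedSum Q A j i = signedSum Q A i j := fun i j =>
    congrFun (congrFun (transpose_signedSum hQ A) i) j
  have hoff : ∀ m, m = k ∨ m = l → ∀ i j, i ≠ m → j ≠ m → signedSum Q A i j = 0 := by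
    intro m hm i j hi hj
    have h := congrFun (congrFun (signedSum_sign Q (fun i => if i = m then -1 else 1) A) i) j
    rw [hflip m hm, map_neg, signedConj_apply] at h
    rw [Matrix.neg_apply] at h
    simp only [if_neg hi, if_neg hj, mul_one, Units.val_one, Int.cast_one, one_mul,
      Equiv.Perm.one_apply] at h
    linarith
  have hdiag : signedSum Q A k l = 0 := by
    have h := congrFun (congrFun (signedSum_perm Q (Equiv.swap k l) A) k) l
    rw [hswap, map_neg, signedConj_apply] at h
    rw [Matrix.neg_apply, Equiv.swap_apply_left, Equiv.swap_apply_right, hsymm k l] at h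
    simp only [Pi.one_apply, mul_one, Units.val_one, Int.cast_one, one_mul] at h
    linarith
  ext i j
  rw [Matrix.zero_apply]
  by_cases h1 : i ≠ k ∧ j ≠ k
  · exact hoff k (Or.inl rfl) i j h1.1 h1.2
  by_cases h2 : i ≠ l ∧ j ≠ l
  · exact hoff l (Or.inr rfl) i j h2.1 h2.2
  have : (i = k ∧ j = l) ∨ (i = l ∧ j = k) := by grind
  rcases this with ⟨rfl, rfl⟩ | ⟨rfl, rfl⟩
  · exact hdiag
  · rw [hsymm]; exact hdiag

/-- The average over all signed permutations of the conjugates of any projection onto the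
symmetric matrices is the symmetrization. -/
lemma signedSum_eq {Q : Matrix (Fin n) (Fin n) ℝ →ₗ[ℝ] Matrix (Fin n) (Fin n) ℝ}
    (hQ : ∀ M, (Q M)ᵀ = Q M) (hQ' : ∀ M, Mᵀ = M → Q M = M) (M : Matrix (Fin n) (Fin n) ℝ) :
    signedSum Q M = (Fintype.card (Equiv.Perm (Fin n)) * Fintype.card (Fin n → ℤˣ) : ℝ) •
      (1 / 2 : ℝ) • (M + Mᵀ) := by
  have hanti : signedSum Q (M - Mᵀ) = 0 := by
    have h : M - Mᵀ = ∑ i, ∑ j, M i j • (Matrix.single i j 1 - Matrix.single j i 1) := by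
      conv_lhs => rw [Matrix.matrix_eq_sum_single M]
      simp [Matrix.transpose_sum, smul_sub, Finset.sum_sub_distrib]
    simp [h, signedSum_single_sub_single hQ]
  have hM : M = (1 / 2 : ℝ) • (M + Mᵀ) + (1 / 2 : ℝ) • (M - Mᵀ) := by module
  conv_lhs => rw [hM]
  rw [map_add, LinearMap.map_smul _ _ (M - Mᵀ), hanti, smul_zero, add_zero]
  exact signedSum_of_symm hQ' (by simp [add_comm])

end SignedPermutations

section OperatorNorm

variable {n : ℕ} {p : Seminorm ℝ (Fin n → ℝ)}

lemma opNormVec_nonneg (L : (Fin n → ℝ) →ₗ[ℝ] (Fin n → ℝ)) : 0 ≤ opNormVec p L :=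
  Real.sSup_nonneg (by rintro _ ⟨v, _, rfl⟩; exact apply_nonneg p _)

lemma opNormVec_le {L : (Fin n → ℝ) →ₗ[ℝ] (Fin n → ℝ)} {C : ℝ} (hC : 0 ≤ C)
    (h : ∀ v, p v ≤ 1 → p (L v) ≤ C) : opNormVec p L ≤ C :=
  Real.sSup_le (by rintro _ ⟨v, hv, rfl⟩; exact h v hv) hC

lemma opNormOp_nonneg
    (P : ((Fin n → ℝ) →ₗ[ℝ] (Fin n → ℝ)) →ₗ[ℝ] ((Fin n → ℝ) →ₗ[ℝ] (Fin n → ℝ))) :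
    0 ≤ opNormOp p P :=
  Real.sSup_nonneg (by rintro _ ⟨L, _, rfl⟩; exact opNormVec_nonneg _)

/-- A seminorm on `ℝⁿ` is symmetric if it is invariant under signed permutations of the
coordinates. -/
def IsSymmetricSeminorm (p : Seminorm ℝ (Fin n → ℝ)) : Prop :=
  ∀ (a : Fin n → ℝ) (ε : Fin n → ℝ), (∀ j, ε j = 1 ∨ ε j = -1) →
    ∀ σ : Equiv.Perm (Fin n), p (fun j => ε j * a (σ j)) = p a

lemma IsSymmetricSeminorm.abs_apply_mul_le (hp : IsSymmetricSeminorm p) (v : Fin n → ℝ)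
    (i : Fin n) : |v i| * p (Pi.single i 1) ≤ p v := by
  have h := hp v (fun j => if j = i then -1 else 1) (fun j => by split_ifs <;> simp) 1
  have h2 : (2 * v i) • (Pi.single i 1 : Fin n → ℝ) =
      v - fun j => (if j = i then (-1 : ℝ) else 1) * v ((1 : Equiv.Perm (Fin n)) j) := by
    ext j
    rcases eq_or_ne j i with rfl | hj
    · simp; ring
    · simp [hj]
  have h3 := map_sub_le_add p v
    (fun j => (if j = i then (-1 : ℝ) else 1) * v ((1 : Equiv.Perm (Fin n)) j))
  rw [← h2, h, map_smul_eq_mul, Real.norm_eq_abs, abs_mul, abs_two] at h3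
  linarith

lemma IsSymmetricSeminorm.abs_apply_le (hp : IsSymmetricSeminorm p)
    (hp0 : ∀ v, p v = 0 → v = 0) (v : Fin n → ℝ) (i : Fin n) :
    |v i| ≤ p v / p (Pi.single i 1) := by
  have hpos : 0 < p (Pi.single i 1) :=
    (apply_nonneg p _).lt_of_ne' fun h => by simpa using congrFun (hp0 _ h) i
  exact (le_div_iff₀ hpos).2 (hp.abs_apply_mul_le v i)

lemma seminorm_sum_le {ι E : Type*} [AddCommGroup E] [Module ℝ E] (q : Seminorm ℝ E)
    (s : Finset ι) (x : ι → E) : q (∑ i ∈ s, x i) ≤ ∑ i ∈ s, q (x i) :=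
  Finset.le_sum_of_subadditive q (map_zero q).le (map_add_le_add q) s x

lemma seminorm_sum_smul_le {ι E : Type*} [AddCommGroup E] [Module ℝ E] (q : Seminorm ℝ E)
    (s : Finset ι) (c : ι → ℝ) (x : ι → E) :
    q (∑ i ∈ s, c i • x i) ≤ ∑ i ∈ s, |c i| * q (x i) :=
  (seminorm_sum_le q s _).trans_eq (by simp [map_smul_eq_mul])

lemma IsSymmetricSeminorm.bddAbove (hp : IsSymmetricSeminorm p)
    (hp0 : ∀ v, p v = 0 → v = 0) (L : (Fin n → ℝ) →ₗ[ℝ] (Fin n → ℝ)) :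
    BddAbove {s : ℝ | ∃ v : Fin n → ℝ, p v ≤ 1 ∧ s = p (L v)} := by
  refine ⟨∑ i, 1 / p (Pi.single i 1) * p (L (Pi.single i 1)), ?_⟩
  rintro _ ⟨v, hv, rfl⟩
  conv_lhs => rw [pi_eq_sum_univ' v, map_sum]
  simp only [map_smul]
  refine (seminorm_sum_smul_le p _ _ _).trans (Finset.sum_le_sum fun i _ => ?_)
  have h := (hp.abs_apply_le hp0 v i).trans
    (div_le_div_of_nonneg_right hv (apply_nonneg p (Pi.single i 1)))
  convert mul_le_mul_of_nonneg_right h (apply_nonneg p (L (Pi.single i 1))) using 4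

lemma IsSymmetricSeminorm.le_opNormVec (hp : IsSymmetricSeminorm p)
    (hp0 : ∀ v, p v = 0 → v = 0) (L : (Fin n → ℝ) →ₗ[ℝ] (Fin n → ℝ)) {v : Fin n → ℝ}
    (hv : p v ≤ 1) : p (L v) ≤ opNormVec p L :=
  le_csSup (hp.bddAbove hp0 L) ⟨v, hv, rfl⟩

/-- The operator norm induced by a symmetric norm, as a seminorm. -/
def IsSymmetricSeminorm.opSeminorm (hp : IsSymmetricSeminorm p) (hp0 : ∀ v, p v = 0 → v = 0) :
    Seminorm ℝ ((Fin n → ℝ) →ₗ[ℝ] (Fin n → ℝ)) :=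
  Seminorm.ofSMulLE (opNormVec p)
    (le_antisymm (opNormVec_le le_rfl fun v _ => by simp) (opNormVec_nonneg _))
    (fun A B => opNormVec_le (add_nonneg (opNormVec_nonneg _) (opNormVec_nonneg _)) fun v hv =>
      (map_add_le_add p _ _).trans
        (add_le_add (hp.le_opNormVec hp0 A hv) (hp.le_opNormVec hp0 B hv)))
    (fun c A => opNormVec_le (mul_nonneg (norm_nonneg c) (opNormVec_nonneg _)) fun v hv => by
      rw [LinearMap.smul_apply, map_smul_eq_mul]
      exact mul_le_mul_of_nonneg_left (hp.le_opNormVec hp0 A hv) (norm_nonneg c))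

lemma IsSymmetricSeminorm.bddAbove_op (hp : IsSymmetricSeminorm p)
    (hp0 : ∀ v, p v = 0 → v = 0)
    (P : ((Fin n → ℝ) →ₗ[ℝ] (Fin n → ℝ)) →ₗ[ℝ] ((Fin n → ℝ) →ₗ[ℝ] (Fin n → ℝ))) :
    BddAbove {s : ℝ | ∃ L : (Fin n → ℝ) →ₗ[ℝ] (Fin n → ℝ),
      opNormVec p L ≤ 1 ∧ s = opNormVec p (P L)} := by
  refine ⟨∑ x : Fin n × Fin n, p (Pi.single x.2 1) * (1 / p (Pi.single x.1 1)) *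
    opNormVec p (P (Matrix.toLin' (Matrix.single x.1 x.2 1))), ?_⟩
  rintro _ ⟨L, hL, rfl⟩
  have hsum : Matrix.toLin' (∑ x : Fin n × Fin n,
      L (Pi.single x.2 1) x.1 • Matrix.single x.1 x.2 (1 : ℝ)) = L := by
    conv_rhs => rw [← Matrix.toLin'_toMatrix' L,
      Matrix.matrix_eq_sum_single (LinearMap.toMatrix' L)]
    simp [Fintype.sum_prod_type, LinearMap.toMatrix'_apply]
  have hle := seminorm_sum_smul_le (hp.opSeminorm hp0) Finset.univ
    (fun x : Fin n × Fin n => L (Pi.single x.2 1) x.1)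
    (fun x => P (Matrix.toLin' (Matrix.single x.1 x.2 (1 : ℝ))))
  simp only [← map_smul, ← map_sum] at hle
  rw [hsum] at hle
  refine hle.trans (Finset.sum_le_sum fun x _ => ?_)
  refine mul_le_mul_of_nonneg_right ?_ (opNormVec_nonneg _)
  set e : Fin n → ℝ := Pi.single x.2 1 with he
  have hpos : 0 < p e :=
    (apply_nonneg p _).lt_of_ne' fun h => by simpa [he] using congrFun (hp0 _ h) x.2
  have hunit : p ((p e)⁻¹ • e) ≤ 1 := by
    rw [map_smul_eq_mul, Real.norm_of_nonneg (inv_nonneg.2 hpos.le), inv_mul_cancel₀ hpos.ne']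
  have hentry := (hp.abs_apply_le hp0 (L ((p e)⁻¹ • e)) x.1).trans
    (div_le_div_of_nonneg_right ((hp.le_opNormVec hp0 L hunit).trans hL) (apply_nonneg p _))
  rw [map_smul, Pi.smul_apply, smul_eq_mul, abs_mul, abs_of_pos (inv_pos.2 hpos),
    inv_mul_le_iff₀ hpos] at hentry
  exact hentry

/-- Conjugation by a signed permutation does not increase the operator norm. -/
lemma IsSymmetricSeminorm.opNormVec_signedConj_le (hp : IsSymmetricSeminorm p)
    (hp0 : ∀ v, p v = 0 → v = 0) (ε : Fin n → ℤˣ) (σ : Equiv.Perm (Fin n))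
    (M : Matrix (Fin n) (Fin n) ℝ) :
    opNormVec p (Matrix.toLin' (signedConj ε σ M)) ≤ opNormVec p (Matrix.toLin' M) := by
  have hsign : ∀ u : ℤˣ, ((u : ℤ) : ℝ) = 1 ∨ ((u : ℤ) : ℝ) = -1 := fun u => by
    rcases Int.units_eq_one_or u with rfl | rfl <;> simp
  refine opNormVec_le (opNormVec_nonneg _) fun v hv => ?_
  have h : Matrix.toLin' (signedConj ε σ M) v = fun i => ((ε i : ℤ) : ℝ) *
      (Matrix.toLin' M fun k => ((ε (σ.symm k) : ℤ) : ℝ) * v (σ.symm k)) (σ i) := by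
    ext i
    simp only [Matrix.toLin'_apply, Matrix.mulVec, dotProduct, signedConj_apply, Finset.mul_sum]
    refine Fintype.sum_equiv σ _ _ fun j => ?_
    simp
    ring
  rw [h, hp _ _ fun j => hsign _]
  refine hp.le_opNormVec hp0 _ ?_
  rwa [hp v (fun k => ((ε (σ.symm k) : ℤ) : ℝ)) fun j => hsign _]

end OperatorNorm


/-- Let `N` be a symmetric norm on `ℝⁿ`, let `X_n = L(ℝⁿ)` carry the induced operator norm,
and let `Y_n ⊆ X_n` be the subspace of symmetric operators. Then `P(L) = (L + Lᵀ)/2` is a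
minimal projection of `X_n` onto `Y_n`: `‖P‖ ≤ ‖P'‖` for every linear projection `P'` of
`X_n` onto `Y_n` (norms of maps on `X_n` being induced by the operator norm of `X_n`). -/
theorem symmetrization_minimal_projection
    (n : ℕ) (N : (Fin n → ℝ) → ℝ)
    -- `N` is a norm on `ℝⁿ`:
    (hNzero : ∀ v, N v = 0 ↔ v = 0)
    (hNsmul : ∀ (a : ℝ) (v), N (a • v) = |a| * N v)
    (hNadd : ∀ v w, N (v + w) ≤ N v + N w)
    -- `N` is symmetric:
    (hNsym : ∀ (a : Fin n → ℝ) (ε : Fin n → ℝ), (∀ j, ε j = 1 ∨ ε j = -1) →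
      ∀ σ : Equiv.Perm (Fin n), N (fun j => ε j * a (σ j)) = N a)
    -- the symmetrization `P(L) = (L + Lᵀ)/2`:
    (P : ((Fin n → ℝ) →ₗ[ℝ] (Fin n → ℝ)) →ₗ[ℝ] ((Fin n → ℝ) →ₗ[ℝ] (Fin n → ℝ)))
    (hP : ∀ L, P L = (1 / 2 : ℝ) • (L + transposeOp L)) :
    -- `P` is a projection of `X_n` onto `Y_n`, and it is minimal:
    (∀ L, P L ∈ symOps n) ∧ (∀ L ∈ symOps n, P L = L) ∧
    (∀ P' : ((Fin n → ℝ) →ₗ[ℝ] (Fin n → ℝ)) →ₗ[ℝ] ((Fin n → ℝ) →ₗ[ℝ] (Fin n → ℝ)),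
      (∀ L, P' L ∈ symOps n) → (∀ L ∈ symOps n, P' L = L) →
      opNormOp N P ≤ opNormOp N P') := by
  obtain ⟨p, rfl⟩ : ∃ p : Seminorm ℝ (Fin n → ℝ), ⇑p = N :=
    ⟨Seminorm.of N hNadd fun a v => by rw [hNsmul, Real.norm_eq_abs], rfl⟩
  have hp : IsSymmetricSeminorm p := hNsym
  have hp0 : ∀ v, p v = 0 → v = 0 := fun v => (hNzero v).1
  have htrans : ∀ L : (Fin n → ℝ) →ₗ[ℝ] (Fin n → ℝ), transposeOp (transposeOp L) = L := fun L => by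
    simp [transposeOp]
  have hadd : ∀ A B : (Fin n → ℝ) →ₗ[ℝ] (Fin n → ℝ),
      transposeOp (A + B) = transposeOp A + transposeOp B := fun A B => by simp [transposeOp]
  refine ⟨fun L => ?_, fun L (hL : transposeOp L = L) => ?_, fun P' hP' hP'' => ?_⟩
  · rw [hP]
    refine (symOps n).smul_mem _ ?_
    change transposeOp _ = _
    rw [hadd, htrans, add_comm]
  · rw [hP, hL]
    module
  refine Real.sSup_le ?_ (opNormOp_nonneg P')
  rintro _ ⟨L, hL, rfl⟩
  set Q : Matrix (Fin n) (Fin n) ℝ →ₗ[ℝ] Matrix (Fin n) (Fin n) ℝ :=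
    LinearMap.toMatrix'.toLinearMap ∘ₗ P' ∘ₗ Matrix.toLin'.toLinearMap
  have hQapply : ∀ M, Q M = LinearMap.toMatrix' (P' (Matrix.toLin' M)) := fun M => rfl
  have hQ : ∀ M, (Q M)ᵀ = Q M := fun M => by
    apply Matrix.toLin'.injective
    have h : transposeOp _ = _ := hP' (Matrix.toLin' M)
    rw [hQapply, Matrix.toLin'_toMatrix']
    exact h
  have hQ' : ∀ M, Mᵀ = M → Q M = M := fun M hM => by
    rw [hQapply, hP'' _ (show transposeOp _ = _ by simp [transposeOp, hM]),
      LinearMap.toMatrix'_toLin']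
  set M := LinearMap.toMatrix' L
  have hLM : Matrix.toLin' M = L := Matrix.toLin'_toMatrix' L
  set c : ℝ := Fintype.card (Equiv.Perm (Fin n)) * Fintype.card (Fin n → ℤˣ) with hc
  have hcpos : 0 < c := by positivity
  have hPL : c • P L = ∑ σ : Equiv.Perm (Fin n), ∑ ε : Fin n → ℤˣ,
      Matrix.toLin' (signedConj (ε ∘ σ.symm) σ.symm (Q (signedConj ε σ M))) := by
    have h := congrArg Matrix.toLin' (signedSum_eq hQ hQ' M)
    rw [signedSum_apply, map_sum] at h
    simp only [map_sum, map_smul, map_add] at h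
    rw [h, hP, hLM]
    rfl
  have hterm : ∀ ε σ, opNormVec p
      (Matrix.toLin' (signedConj (ε ∘ σ.symm) σ.symm (Q (signedConj ε σ M)))) ≤
      opNormOp p P' := fun ε σ => by
    refine (hp.opNormVec_signedConj_le hp0 _ _ _).trans ?_
    rw [hQapply, Matrix.toLin'_toMatrix']
    refine le_csSup (hp.bddAbove_op hp0 P') ⟨_, ?_, rfl⟩
    exact (hp.opNormVec_signedConj_le hp0 ε σ M).trans (by rwa [hLM])
  set q := hp.opSeminorm hp0
  have hsub : ∀ {ι : Type} [Fintype ι] (f : ι → (Fin n → ℝ) →ₗ[ℝ] (Fin n → ℝ)) (K : ℝ),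
      (∀ i, q (f i) ≤ K) → q (∑ i, f i) ≤ Fintype.card ι * K := fun f K hf =>
    (seminorm_sum_le q _ _).trans
      ((Finset.sum_le_sum fun i _ => hf i).trans_eq (by simp))
  have hfinal : q (c • P L) ≤ c * opNormOp p P' := by
    rw [hPL, hc, mul_assoc]
    exact hsub _ _ fun σ => hsub _ _ fun ε => hterm ε σ
  rw [map_smul_eq_mul, Real.norm_of_nonneg hcpos.le] at hfinal
  exact le_of_mul_le_mul_left hfinal hcpos
end
end
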